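/- arXiv:1908.05537 — 8 statements merged into one kernel-verified Lean document; each statement's English description precedes it below -/
import Mathlib

section
/- Assume ρ₁(k), ρ₂(k) ∈ [0,1) for all k = 1,…,N_h, and that ρ₁(k) ≥ ρ₁(N_h−k+1) and ρ₂(k) ≥ ρ₂(N_h−k+1) for every k = 1,…,N_c. Then the coarse matrix A_{2h} = R_{2h}^h A_h P_{2h}^h ∈ ℝ^{2N_c×2N_c} has full rank, i.e., it is invertible. -/
open Matrix Real

lemma sum_sin_mul_sin_eq_zero (N : ℕ) (a b : ℝ) (ha : sin (a * (N + 1)) = 0)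
    (hb : sin (b * (N + 1)) = 0) (hab : cos a ≠ cos b) :
    ∑ j : Fin N, sin (a * ((j : ℕ) + 1)) * sin (b * ((j : ℕ) + 1)) = 0 := by
  have key : (2 * cos a - 2 * cos b) *
      ∑ j ∈ Finset.range N, sin (a * ((j : ℝ) + 1)) * sin (b * ((j : ℝ) + 1)) = 0 := by
    let W : ℕ → ℝ := fun j => sin (a * ((j : ℝ) + 1)) * sin (b * j) -
      sin (a * j) * sin (b * ((j : ℝ) + 1))
    have hW : W N - W 0 = 0 := by simp [W, ha, hb]
    rw [← hW, ← Finset.sum_range_sub, Finset.mul_sum]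
    refine Finset.sum_congr rfl fun j _ => ?_
    have e (t : ℝ) : sin (t * ((j : ℝ) + 1 + 1)) =
        2 * cos t * sin (t * ((j : ℝ) + 1)) - sin (t * j) := by
      have h₁ : t * ((j : ℝ) + 1 + 1) = t * ((j : ℝ) + 1) + t := by ring
      have h₂ : t * (j : ℝ) = t * ((j : ℝ) + 1) - t := by ring
      rw [h₁, h₂, sin_add, sin_sub]
      ring
    simp only [W, Nat.cast_add, Nat.cast_one, e]
    ring
  rw [Fin.sum_univ_eq_sum_range
    (fun j : ℕ => sin (a * ((j : ℝ) + 1)) * sin (b * ((j : ℝ) + 1))) N]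
  refine (mul_eq_zero.mp key).resolve_left fun h => hab ?_
  linarith

lemma exists_orthogonal_diagonalizing {n : Type*} [Fintype n] [DecidableEq n]
    (v : n → n → ℝ) (hv : ∀ i, v i ≠ 0) (horth : ∀ i j, i ≠ j → v i ⬝ᵥ v j = 0) :
    ∃ U : Matrix n n ℝ, Uᵀ * U = 1 ∧
      ∀ (G : Matrix n n ℝ) (r : n → ℝ), (∀ i, G *ᵥ v i = r i • v i) →
        G = Uᵀ * diagonal r * U := by
  let c : n → ℝ := fun i => (√(v i ⬝ᵥ v i))⁻¹
  let U : Matrix n n ℝ := Matrix.of fun i => c i • v i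
  have hpos (i : n) : 0 < v i ⬝ᵥ v i :=
    lt_of_le_of_ne (Finset.sum_nonneg fun _ _ => mul_self_nonneg _)
      fun h => hv i (dotProduct_self_eq_zero.mp h.symm)
  have hU : U * Uᵀ = 1 := by
    ext i j
    have : (U * Uᵀ) i j = c i * c j * (v i ⬝ᵥ v j) := by
      simp only [mul_apply, U, transpose_apply, of_apply, Pi.smul_apply, smul_eq_mul,
        dotProduct, Finset.mul_sum]
      exact Finset.sum_congr rfl fun _ _ => by ring
    rw [this]
    by_cases h : i = j
    · subst h
      rw [one_apply_eq, ← mul_inv, mul_self_sqrt (hpos i).le, inv_mul_cancel₀ (hpos i).ne']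
    · rw [one_apply_ne h, horth i j h, mul_zero]
  have hU' : Uᵀ * U = 1 := mul_eq_one_comm.mp hU
  refine ⟨U, hU', fun G r hG => ?_⟩
  have hGU : G * Uᵀ = Uᵀ * diagonal r := by
    ext i j
    have h := congrFun (hG j) i
    simp only [mulVec, dotProduct, Pi.smul_apply, smul_eq_mul] at h
    rw [mul_diagonal]
    simp only [mul_apply, U, transpose_apply, of_apply, Pi.smul_apply, smul_eq_mul]
    calc ∑ k, G i k * (c j * v j k) = c j * ∑ k, G i k * v j k := by
          rw [Finset.mul_sum]; exact Finset.sum_congr rfl fun _ _ => by ring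
      _ = c j * v j i * r j := by rw [h]; ring
  rw [← hGU, Matrix.mul_assoc, hU', Matrix.mul_one]

lemma eq_zero_of_dotProduct_sub_le {n : Type*} [Fintype n] [DecidableEq n]
    (U : Matrix n n ℝ) (hU : Uᵀ * U = 1) (r s : n → ℝ)
    (hr : ∀ i, |r i| < 1) (hs : ∀ i, |s i| < 1) (x y : n → ℝ)
    (h : x ⬝ᵥ (x - (Uᵀ * diagonal r * U) *ᵥ y) + y ⬝ᵥ (y - (Uᵀ * diagonal s * U) *ᵥ x) ≤ 0) :
    x = 0 ∧ y = 0 := by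
  have hdiag (t x y : n → ℝ) : x ⬝ᵥ (Uᵀ * diagonal t * U) *ᵥ y =
      ∑ i, t i * (U *ᵥ x) i * (U *ᵥ y) i := by
    rw [← mulVec_mulVec, ← mulVec_mulVec, dotProduct_mulVec, vecMul_transpose, dotProduct]
    exact Finset.sum_congr rfl fun i _ => by rw [mulVec_diagonal]; ring
  have hself (x : n → ℝ) : x ⬝ᵥ x = ∑ i, (U *ᵥ x) i * (U *ᵥ x) i := by
    have := hdiag 1 x x
    simpa [hU] using this
  have hinj (x : n → ℝ) (hx : U *ᵥ x = 0) : x = 0 := by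
    rw [← one_mulVec x, ← hU, ← mulVec_mulVec, hx, mulVec_zero]
  rw [dotProduct_sub, dotProduct_sub, hself x, hself y, hdiag, hdiag, ← Finset.sum_sub_distrib,
    ← Finset.sum_sub_distrib, ← Finset.sum_add_distrib] at h
  generalize hα : U *ᵥ x = α at h
  generalize hβ : U *ᵥ y = β at h
  have hbound (i : n) : (2 - |r i + s i|) / 2 * (α i ^ 2 + β i ^ 2) ≤
      α i * α i - r i * α i * β i + (β i * β i - s i * β i * α i) := by
    have h₁ : (r i + s i) * (α i * β i) ≤ |r i + s i| * |α i * β i| :=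
      (le_abs_self _).trans (abs_mul _ _).le
    have h₂ : |α i * β i| ≤ (α i ^ 2 + β i ^ 2) / 2 := by
      rw [abs_le]
      constructor <;> nlinarith [sq_nonneg (α i + β i), sq_nonneg (α i - β i)]
    nlinarith [mul_le_mul_of_nonneg_left h₂ (abs_nonneg (r i + s i))]
  have hlt (i : n) : 0 < (2 - |r i + s i|) / 2 := by
    linarith [abs_add_le (r i) (s i), hr i, hs i]
  have hnonneg (i : n) : 0 ≤ (2 - |r i + s i|) / 2 * (α i ^ 2 + β i ^ 2) :=
    mul_nonneg (hlt i).le (by positivity)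
  have hzero (i : n) : α i ^ 2 + β i ^ 2 = 0 := by
    have hle := (Finset.sum_le_sum fun i (_ : i ∈ Finset.univ) => hbound i).trans h
    have hsum := le_antisymm hle (Finset.sum_nonneg fun i _ => hnonneg i)
    rw [Finset.sum_eq_zero_iff_of_nonneg fun i _ => hnonneg i] at hsum
    exact (mul_eq_zero.mp (hsum i (Finset.mem_univ i))).resolve_left (hlt i).ne'
  refine ⟨hinj x ?_, hinj y ?_⟩
  · rw [hα]; ext i
    exact pow_eq_zero_iff two_ne_zero |>.mp
      (by nlinarith [hzero i, sq_nonneg (α i), sq_nonneg (β i)])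
  · rw [hβ]; ext i
    exact pow_eq_zero_iff two_ne_zero |>.mp
      (by nlinarith [hzero i, sq_nonneg (α i), sq_nonneg (β i)])

theorem stmt8
    (l : ℕ) (hl : 2 ≤ l)
    (Nc Nh : ℕ) (hNc : Nc = 2 ^ (l - 1) - 1) (hNh : Nh = 2 * Nc + 1)
    (h : ℝ) (hh : h = 1 / ((Nh : ℝ) + 1))
    (ψ : ℕ → Fin Nh → ℝ)
    (hψ : ∀ (k : ℕ) (j : Fin Nh), ψ k j = Real.sin (k * Real.pi * h * ((j : ℕ) + 1)))
    (Pt : Matrix (Fin Nh) (Fin Nc) ℝ)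
    (hPt : ∀ (r : Fin Nh) (c : Fin Nc),
      Pt r c = if (r : ℕ) = 2 * (c : ℕ) then (1 : ℝ)/2
        else if (r : ℕ) = 2 * (c : ℕ) + 1 then 1
        else if (r : ℕ) = 2 * (c : ℕ) + 2 then (1 : ℝ)/2 else 0)
    (Rt : Matrix (Fin Nc) (Fin Nh) ℝ) (hRt : Rt = ((1 : ℝ)/2) • Ptᵀ)
    (ρ₁ ρ₂ : ℕ → ℝ)
    (G₁ G₂ : Matrix (Fin Nh) (Fin Nh) ℝ)
    (hG₁ : ∀ k : ℕ, 1 ≤ k → k ≤ Nh → G₁.mulVec (ψ k) = ρ₁ k • ψ k)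
    (hG₂ : ∀ k : ℕ, 1 ≤ k → k ≤ Nh → G₂.mulVec (ψ k) = ρ₂ k • ψ k)
    (Ah : Matrix (Fin Nh ⊕ Fin Nh) (Fin Nh ⊕ Fin Nh) ℝ)
    (hAh : Ah = Matrix.fromBlocks 1 (-G₁) (-G₂) 1)
    (P2h : Matrix (Fin Nh ⊕ Fin Nh) (Fin Nc ⊕ Fin Nc) ℝ)
    (hP2h : P2h = Matrix.fromBlocks Pt 0 0 Pt)
    (R2h : Matrix (Fin Nc ⊕ Fin Nc) (Fin Nh ⊕ Fin Nh) ℝ)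
    (hR2h : R2h = Matrix.fromBlocks Rt 0 0 Rt)
    (hρ₁ : ∀ k : ℕ, 1 ≤ k → k ≤ Nh → 0 ≤ ρ₁ k ∧ ρ₁ k < 1)
    (hρ₂ : ∀ k : ℕ, 1 ≤ k → k ≤ Nh → 0 ≤ ρ₂ k ∧ ρ₂ k < 1)
    (hmono₁ : ∀ k : ℕ, 1 ≤ k → k ≤ Nc → ρ₁ (Nh - k + 1) ≤ ρ₁ k)
    (hmono₂ : ∀ k : ℕ, 1 ≤ k → k ≤ Nc → ρ₂ (Nh - k + 1) ≤ ρ₂ k) :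
    IsUnit (R2h * Ah * P2h) := by
  have hN : (0 : ℝ) < (Nh : ℝ) + 1 := by positivity
  have hpos : 0 < h := by rw [hh]; positivity
  have hhN : h * ((Nh : ℝ) + 1) = 1 := by rw [hh]; field_simp
  let θ : Fin Nh → ℝ := fun i => ((((i : ℕ) + 1 : ℕ) : ℝ)) * π * h
  have hθpos (i : Fin Nh) : 0 < θ i := by positivity
  have hθlt (i : Fin Nh) : θ i < π := by
    have hi : ((((i : ℕ) + 1 : ℕ) : ℝ)) < (Nh : ℝ) + 1 := by
      exact_mod_cast Nat.succ_lt_succ i.2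
    calc θ i = π * (((((i : ℕ) + 1 : ℕ) : ℝ)) * h) := by ring
      _ < π * (((Nh : ℝ) + 1) * h) := by gcongr
      _ = π := by rw [mul_comm _ h, hhN, mul_one]
  have hθsin (i : Fin Nh) : sin (θ i * ((Nh : ℝ) + 1)) = 0 := by
    have : θ i * ((Nh : ℝ) + 1) = (((i : ℕ) + 1 : ℕ) : ℝ) * π := by
      rw [show θ i * ((Nh : ℝ) + 1) =
        (((i : ℕ) + 1 : ℕ) : ℝ) * π * (h * ((Nh : ℝ) + 1)) by ring, hhN, mul_one]
    rw [this, sin_nat_mul_pi]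
  let v : Fin Nh → Fin Nh → ℝ := fun i => ψ ((i : ℕ) + 1)
  have hv (i : Fin Nh) : v i ≠ 0 := by
    intro h0
    have h1 := congrFun h0 ⟨0, i.pos⟩
    simp only [v, hψ, Pi.zero_apply, CharP.cast_eq_zero, zero_add, mul_one] at h1
    exact (sin_pos_of_pos_of_lt_pi (hθpos i) (hθlt i)).ne' h1
  have horth (i j : Fin Nh) (hij : i ≠ j) : v i ⬝ᵥ v j = 0 := by
    simp only [v, dotProduct, hψ]
    refine sum_sin_mul_sin_eq_zero Nh (θ i) (θ j) (hθsin i) (hθsin j) fun hc => hij ?_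
    have hθ := injOn_cos ⟨(hθpos i).le, (hθlt i).le⟩ ⟨(hθpos j).le, (hθlt j).le⟩ hc
    have h1 := mul_right_cancel₀ pi_ne_zero (mul_right_cancel₀ hpos.ne' hθ)
    have h2 : (i : ℕ) + 1 = (j : ℕ) + 1 := by exact_mod_cast h1
    exact Fin.ext (by omega)
  obtain ⟨U, hU, hdiag⟩ := exists_orthogonal_diagonalizing v hv horth
  have habs {ρ : ℕ → ℝ} (hρ : ∀ k : ℕ, 1 ≤ k → k ≤ Nh → 0 ≤ ρ k ∧ ρ k < 1) (i : Fin Nh) :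
      |ρ ((i : ℕ) + 1)| < 1 := by
    obtain ⟨h0, h1⟩ := hρ ((i : ℕ) + 1) (by omega) (by omega)
    rwa [abs_of_nonneg h0]
  have hG₁' := hdiag G₁ (fun i => ρ₁ ((i : ℕ) + 1)) fun i => hG₁ _ (by omega) (by omega)
  have hG₂' := hdiag G₂ (fun i => ρ₂ ((i : ℕ) + 1)) fun i => hG₂ _ (by omega) (by omega)
  have hPinj (u : Fin Nc → ℝ) (hu : Pt *ᵥ u = 0) : u = 0 := by
    ext c
    have h1 := congrFun hu ⟨2 * (c : ℕ) + 1, by omega⟩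
    rw [mulVec, dotProduct, Finset.sum_eq_single c] at h1
    · simpa [hPt] using h1
    · intro b _ hb
      have hb' : (b : ℕ) ≠ c := fun h => hb (Fin.ext h)
      rw [hPt, if_neg (by simp only; omega), if_neg (by simp only; omega),
        if_neg (by simp only; omega), zero_mul]
    · simp
  rw [← mulVec_injective_iff_isUnit, ← coe_mulVecLin, injective_iff_map_eq_zero]
  intro w hw
  obtain ⟨u, w', rfl⟩ : ∃ u w', w = Sum.elim u w' := ⟨_, _, (Sum.elim_comp_inl_inr w).symm⟩
  rw [mulVecLin_apply, ← mulVec_mulVec, ← mulVec_mulVec, hR2h, hAh, hP2h] at hw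
  simp only [fromBlocks_mulVec, Sum.elim_comp_inl, Sum.elim_comp_inr, zero_mulVec, add_zero,
    zero_add, one_mulVec, neg_mulVec] at hw
  have hw₁ : Rt *ᵥ (Pt *ᵥ u - G₁ *ᵥ (Pt *ᵥ w')) = 0 := by
    ext i; simpa [sub_eq_add_neg] using congrFun hw (Sum.inl i)
  have hw₂ : Rt *ᵥ (Pt *ᵥ w' - G₂ *ᵥ (Pt *ᵥ u)) = 0 := by
    ext i; simpa [sub_eq_add_neg, add_comm] using congrFun hw (Sum.inr i)
  have hRP (u : Fin Nc → ℝ) (z : Fin Nh → ℝ) (hz : Rt *ᵥ z = 0) : (Pt *ᵥ u) ⬝ᵥ z = 0 := by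
    rw [hRt, smul_mulVec, smul_eq_zero] at hz
    rw [← vecMul_transpose, ← dotProduct_mulVec, hz.resolve_left (by norm_num), dotProduct_zero]
  have hle := (congrArg₂ (· + ·) (hRP u _ hw₁) (hRP w' _ hw₂)).trans (add_zero 0)
  rw [hG₁', hG₂'] at hle
  obtain ⟨hx, hy⟩ := eq_zero_of_dotProduct_sub_le U hU _ _ (habs hρ₁) (habs hρ₂) _ _ hle.le
  rw [hPinj u hx, hPinj w' hy, Sum.elim_zero_zero]
end

section
/- Fix k ∈ {1,…,N_c} and set k̃ = N_h−k+1, c = cos(kπh/2), s = sin(kπh/2). Assume ρ₁(k), ρ₁(k̃), ρ₂(k), ρ₂(k̃) ∈ [0,1). Then the 2×2 matrix Λ₂(k) = V(k)ᵀH(k)V(k), which equals [[c⁴+s⁴, −(c⁴ρ₁(k)+s⁴ρ₁(k̃))],[−(c⁴ρ₂(k)+s⁴ρ₂(k̃)), c⁴+s⁴]], has exactly the two eigenvalues λ_{1,2} = c⁴+s⁴ ± √((c⁴ρ₁(k)+s⁴ρ₁(k̃))(c⁴ρ₂(k)+s⁴ρ₂(k̃))), both eigenvalues are nonzero, and Λ₂(k)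 is invertible. -/
open Matrix Real

/-- A real `2 × 2` matrix with constant diagonal `a` and off-diagonal entries of nonnegative
product `x * y` has spectrum `{a + √(x * y), a - √(x * y)}`. -/
theorem spectrum_constDiag_fin_two (a x y : ℝ) (hxy : 0 ≤ x * y) :
    spectrum ℝ !![a, -x; -y, a] = {a + √(x * y), a - √(x * y)} := by
  ext μ
  have hdet : (algebraMap ℝ (Matrix (Fin 2) (Fin 2) ℝ) μ - !![a, -x; -y, a]).det
      = (μ - (a + √(x * y))) * (μ - (a - √(x * y))) := by
    simp only [det_fin_two, Matrix.sub_apply, algebraMap_matrix_apply, of_apply, cons_val',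
      cons_val_zero,
      cons_val_one, cons_val_fin_one, Algebra.algebraMap_self, RingHom.id_apply]
    simp only [Fin.isValue, ↓reduceIte, zero_ne_one, one_ne_zero]
    linear_combination Real.sq_sqrt hxy
  rw [spectrum.mem_iff, isUnit_iff_isUnit_det, hdet, isUnit_iff_ne_zero, not_not, mul_eq_zero,
    sub_eq_zero, sub_eq_zero, Set.mem_insert_iff, Set.mem_singleton_iff]

/-- A nonnegative combination with positive total weight of numbers less than one is less than
the total weight. -/
theorem weighted_add_lt {p q r t : ℝ} (hp : 0 ≤ p) (hq : 0 ≤ q) (hpq : 0 < p + q)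
    (hr : r < 1) (ht : t < 1) : p * r + q * t < p + q := by
  rcases hp.eq_or_lt with rfl | hp
  · nlinarith
  · nlinarith [mul_nonneg hq (sub_nonneg.2 ht.le), mul_pos hp (sub_pos.2 hr)]

theorem stmt9
    (l : ℕ) (hl : 2 ≤ l)
    (Nc Nh : ℕ) (hNc : Nc = 2 ^ (l - 1) - 1) (hNh : Nh = 2 * Nc + 1)
    (h : ℝ) (hh : h = 1 / ((Nh : ℝ) + 1))
    (k : ℕ) (hk1 : 1 ≤ k) (hk2 : k ≤ Nc)
    (kt : ℕ) (hkt : kt = Nh - k + 1)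
    (c s : ℝ) (hc : c = Real.cos (k * Real.pi * h / 2)) (hs : s = Real.sin (k * Real.pi * h / 2))
    (ρ₁ ρ₂ : ℕ → ℝ)
    (hρ₁k : 0 ≤ ρ₁ k ∧ ρ₁ k < 1) (hρ₁kt : 0 ≤ ρ₁ kt ∧ ρ₁ kt < 1)
    (hρ₂k : 0 ≤ ρ₂ k ∧ ρ₂ k < 1) (hρ₂kt : 0 ≤ ρ₂ kt ∧ ρ₂ kt < 1)
    (V : Matrix (Fin 4) (Fin 2) ℝ)
    (hV : V = !![c^2, 0; -s^2, 0; 0, c^2; 0, -s^2])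
    (H : Matrix (Fin 4) (Fin 4) ℝ)
    (hH : H = !![1, 0, -ρ₁ k, 0; 0, 1, 0, -ρ₁ kt; -ρ₂ k, 0, 1, 0; 0, -ρ₂ kt, 0, 1])
    (Λ₂ : Matrix (Fin 2) (Fin 2) ℝ) (hΛ₂ : Λ₂ = Vᵀ * H * V) :
    Λ₂ = !![c^4 + s^4, -(c^4 * ρ₁ k + s^4 * ρ₁ kt);
            -(c^4 * ρ₂ k + s^4 * ρ₂ kt), c^4 + s^4] ∧
    spectrum ℝ Λ₂ =
      {c^4 + s^4 + Real.sqrt ((c^4 * ρ₁ k + s^4 * ρ₁ kt) * (c^4 * ρ₂ k + s^4 * ρ₂ kt)),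
       c^4 + s^4 - Real.sqrt ((c^4 * ρ₁ k + s^4 * ρ₁ kt) * (c^4 * ρ₂ k + s^4 * ρ₂ kt))} ∧
    c^4 + s^4 + Real.sqrt ((c^4 * ρ₁ k + s^4 * ρ₁ kt) * (c^4 * ρ₂ k + s^4 * ρ₂ kt)) ≠ 0 ∧
    c^4 + s^4 - Real.sqrt ((c^4 * ρ₁ k + s^4 * ρ₁ kt) * (c^4 * ρ₂ k + s^4 * ρ₂ kt)) ≠ 0 ∧
    IsUnit Λ₂ := by
  have hcs : c ^ 2 + s ^ 2 = 1 := by rw [hc, hs]; exact Real.cos_sq_add_sin_sq _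
  have hpos : 0 < c ^ 4 + s ^ 4 := by nlinarith [sq_nonneg (c ^ 2 - s ^ 2)]
  have hc4 : 0 ≤ c ^ 4 := by positivity
  have hs4 : 0 ≤ s ^ 4 := by positivity
  have hΛ : Λ₂ = !![c^4 + s^4, -(c^4 * ρ₁ k + s^4 * ρ₁ kt);
      -(c^4 * ρ₂ k + s^4 * ρ₂ kt), c^4 + s^4] := by
    rw [hΛ₂, hV, hH]
    ext i j
    fin_cases i <;> fin_cases j <;>
      simp [Matrix.mul_apply, Fin.sum_univ_four] <;> ring
  have hx := weighted_add_lt hc4 hs4 hpos hρ₁k.2 hρ₁kt.2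
  have hy := weighted_add_lt hc4 hs4 hpos hρ₂k.2 hρ₂kt.2
  have hx0 := add_nonneg (mul_nonneg hc4 hρ₁k.1) (mul_nonneg hs4 hρ₁kt.1)
  have hy0 := add_nonneg (mul_nonneg hc4 hρ₂k.1) (mul_nonneg hs4 hρ₂kt.1)
  have hspec := spectrum_constDiag_fin_two (c ^ 4 + s ^ 4) _ _ (mul_nonneg hx0 hy0)
  have hlt : √((c^4 * ρ₁ k + s^4 * ρ₁ kt) * (c^4 * ρ₂ k + s^4 * ρ₂ kt)) < c ^ 4 + s ^ 4 := by
    rw [Real.sqrt_lt' hpos, sq]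
    exact mul_lt_mul'' hx hy hx0 hy0
  rw [← hΛ] at hspec
  have hplus := (add_pos_of_pos_of_nonneg hpos (Real.sqrt_nonneg
    ((c^4 * ρ₁ k + s^4 * ρ₁ kt) * (c^4 * ρ₂ k + s^4 * ρ₂ kt)))).ne'
  have hminus := (sub_pos.2 hlt).ne'
  refine ⟨hΛ, hspec, hplus, hminus, ?_⟩
  rw [← spectrum.zero_notMem_iff ℝ, hspec, Set.mem_insert_iff, Set.mem_singleton_iff]
  exact not_or.2 ⟨hplus.symm, hminus.symm⟩
end

section
/- Assume ρ₁(k), ρ₂(k) ∈ [0,1) for all k and ρ_j(k) ≥ ρ_j(N_h−k+1) for k = 1,…,N_c, j = 1,2 (so that A_{2h} is invertible). Then for every k = 1,…,N_c, with M_k ∈ ℝ^{2N_h×4} the matrix whose columns are (ψ_k,0), (ψ_{k̃},0), (0,ψ_k), (0,ψ_{k̃}) (where k̃ = N_h−k+1), the two-grid iteration matrix T_h = G_h^{n₂}(I − P_{2h}^h A_{2h}^{-1} R_{2h}^h A_h)G_h^{n₁} satisfies T_h M_k = M_k G̃_k, where G̃_k = D_{n₂}(k)(D_{n₁}(k) −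 V(k)Λ₂(k)^{-1}Λ₁(k)). -/
open Matrix Real

/-- The discrete sine mode `j ↦ sin (θ (j + 1))` on `n` grid points. -/
noncomputable def sineMode (n : ℕ) (θ : ℝ) : Fin n → ℝ := fun j => Real.sin (θ * ((j : ℕ) + 1))

/-- Sum of the two neighbours, with zero boundary values. -/
def neighbourSum (n : ℕ) : Module.End ℝ (Fin n → ℝ) where
  toFun v i := (if h : (i : ℕ) + 1 < n then v ⟨i + 1, h⟩ else 0) +
    (if 0 < (i : ℕ) then v ⟨i - 1, by omega⟩ else 0)
  map_add' v w := by
    ext i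
    simp only [Pi.add_apply]
    split_ifs <;> ring
  map_smul' a v := by
    ext i
    simp only [Pi.smul_apply, smul_eq_mul, RingHom.id_apply]
    split_ifs <;> ring

theorem neighbourSum_sineMode (n : ℕ) {θ : ℝ} (hθ : Real.sin (θ * ((n : ℝ) + 1)) = 0) :
    neighbourSum n (sineMode n θ) = (2 * Real.cos θ) • sineMode n θ := by
  ext i
  have key : 2 * Real.cos θ * Real.sin (θ * ((i : ℕ) + 1)) =
      Real.sin (θ * ((i : ℕ) + 2)) + Real.sin (θ * (i : ℕ)) := by
    rw [show θ * ((i : ℕ) + 2 : ℝ) = θ * ((i : ℕ) + 1) + θ by ring,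
      show θ * ((i : ℕ) : ℝ) = θ * ((i : ℕ) + 1) - θ by ring, Real.sin_add, Real.sin_sub]
    ring
  simp only [neighbourSum, LinearMap.coe_mk, AddHom.coe_mk, sineMode, Pi.smul_apply, smul_eq_mul]
  rw [key]
  congr 1
  · split_ifs with hi
    · push_cast
      ring_nf
    · have hn : (n : ℝ) = (i : ℕ) + 1 := by exact_mod_cast (show n = (i : ℕ) + 1 by omega)
      rw [← hθ, hn]
      ring_nf
  · split_ifs with hi
    · rw [Nat.cast_sub hi]
      push_cast
      ring_nf
    · rw [show (i : ℕ) = 0 by omega]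
      simp

theorem sineMode_linearIndependent (n : ℕ) :
    LinearIndependent ℝ
      (fun k : Fin n => sineMode n (((k : ℕ) + 1 : ℝ) * π / (n + 1))) := by
  have hpos (k : Fin n) : 0 < ((k : ℕ) + 1 : ℝ) * π / (n + 1) := by positivity
  have hlt (k : Fin n) : ((k : ℕ) + 1 : ℝ) * π / (n + 1) < π := by
    have hk : ((k : ℕ) : ℝ) < n := by exact_mod_cast k.2
    rw [div_lt_iff₀ (by positivity)]
    nlinarith [Real.pi_pos]
  refine Module.End.eigenvectors_linearIndependent' (neighbourSum n)
    (fun k : Fin n => 2 * Real.cos (((k : ℕ) + 1 : ℝ) * π / (n + 1))) ?_ _ ?_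
  · intro a b hab
    have hcos := Real.injOn_cos ⟨(hpos a).le, (hlt a).le⟩ ⟨(hpos b).le, (hlt b).le⟩
      (mul_left_cancel₀ two_ne_zero hab)
    have hn : (n : ℝ) + 1 ≠ 0 := by positivity
    field_simp at hcos
    exact Fin.ext (by exact_mod_cast add_right_cancel hcos)
  · intro k
    refine ⟨Module.End.mem_eigenspace_iff.2 (neighbourSum_sineMode n ?_), fun h0 => ?_⟩
    · rw [div_mul_cancel₀ _ (by positivity)]
      exact_mod_cast Real.sin_nat_mul_pi ((k : ℕ) + 1)
    · have hn : 0 < n := k.pos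
      have := congrFun h0 ⟨0, hn⟩
      simp only [sineMode, Nat.cast_zero, zero_add, mul_one, Pi.zero_apply] at this
      exact (Real.sin_pos_of_pos_of_lt_pi (hpos k) (hlt k)).ne' this

theorem sineMode_pi_sub (n : ℕ) (θ : ℝ) (j : Fin n) :
    sineMode n (π - θ) j = (-1) ^ (j : ℕ) * sineMode n θ j := by
  have h1 := Real.sin_nat_mul_pi ((j : ℕ) + 1)
  have h2 := Real.cos_nat_mul_pi ((j : ℕ) + 1)
  push_cast at h1 h2
  rw [sineMode, sineMode, sub_mul, mul_comm π, Real.sin_sub, h1, h2, pow_succ]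
  ring

/-- Linear interpolation from `n` coarse points to `2 n + 1` fine points. -/
def IsInterpolation {N n : ℕ} (P : Matrix (Fin N) (Fin n) ℝ) : Prop :=
  ∀ (r : Fin N) (c : Fin n),
    P r c = if (r : ℕ) = 2 * (c : ℕ) then (1 : ℝ)/2
      else if (r : ℕ) = 2 * (c : ℕ) + 1 then 1
      else if (r : ℕ) = 2 * (c : ℕ) + 2 then (1 : ℝ)/2 else 0

theorem IsInterpolation.mulVec_sineMode {N n : ℕ} {P : Matrix (Fin N) (Fin n) ℝ}
    (hP : IsInterpolation P) (hN : N = 2 * n + 1) {θ : ℝ}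
    (hθ : Real.sin (2 * θ * ((n : ℝ) + 1)) = 0) :
    P *ᵥ sineMode n (2 * θ) = Real.cos (θ / 2) ^ 2 • sineMode N θ -
      Real.sin (θ / 2) ^ 2 • sineMode N (π - θ) := by
  ext r
  have hcos : Real.cos θ = Real.cos (θ / 2) ^ 2 - Real.sin (θ / 2) ^ 2 := by
    rw [← Real.cos_two_mul', mul_div_cancel₀ _ two_ne_zero]
  have hone := Real.cos_sq_add_sin_sq (θ / 2)
  have hsum : (P *ᵥ sineMode n (2 * θ)) r = ∑ c ∈ Finset.range n,
      (if (r : ℕ) = 2 * c then (1 : ℝ)/2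
        else if (r : ℕ) = 2 * c + 1 then 1
        else if (r : ℕ) = 2 * c + 2 then (1 : ℝ)/2 else 0) *
      Real.sin (2 * θ * (c + 1)) := by
    rw [Finset.sum_range]
    simp only [mulVec, dotProduct, hP r, sineMode]
  rw [hsum]
  simp only [Pi.sub_apply, Pi.smul_apply, smul_eq_mul, sineMode_pi_sub]
  obtain ⟨m, hm | hm⟩ := Nat.even_or_odd' (r : ℕ)
  · have hterm (c : ℕ) : (if (r : ℕ) = 2 * c then (1 : ℝ)/2
        else if (r : ℕ) = 2 * c + 1 then 1
        else if (r : ℕ) = 2 * c + 2 then (1 : ℝ)/2 else 0) * Real.sin (2 * θ * (c + 1)) =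
        (if m = c then 1 / 2 * Real.sin (2 * θ * (m + 1)) else 0) +
        (if m = c + 1 then 1 / 2 * Real.sin (2 * θ * m) else 0) := by
      rcases eq_or_ne m c with rfl | h1
      · simp [hm]
      rcases eq_or_ne m (c + 1) with rfl | h2
      · rw [hm]
        simp [mul_add]
      · rw [if_neg (by omega), if_neg (by omega), if_neg (by omega), if_neg h1, if_neg h2]
        simp
    have hfirst : ∑ c ∈ Finset.range n,
        (if m = c then 1 / 2 * Real.sin (2 * θ * (m + 1)) else 0) =
        1 / 2 * Real.sin (2 * θ * (m + 1)) := by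
      rw [Finset.sum_ite_eq]
      split_ifs with h
      · rfl
      · rw [show m = n by rw [Finset.mem_range] at h; omega, hθ, mul_zero]
    have hsecond : ∑ c ∈ Finset.range n,
        (if m = c + 1 then 1 / 2 * Real.sin (2 * θ * m) else 0) =
        1 / 2 * Real.sin (2 * θ * m) := by
      rcases m with _ | m
      · simp
      · simp only [Nat.add_right_cancel_iff]
        rw [Finset.sum_ite_eq, if_pos (Finset.mem_range.2 (by omega))]
    rw [Finset.sum_congr rfl fun c _ => hterm c, Finset.sum_add_distrib, hfirst, hsecond,
      sineMode, hm, Even.neg_one_pow (even_two_mul m)]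
    push_cast
    rw [show 2 * θ * ((m : ℝ) + 1) = θ * (2 * m + 1) + θ by ring,
      show 2 * θ * (m : ℝ) = θ * (2 * m + 1) - θ by ring, Real.sin_add, Real.sin_sub, hcos]
    ring
  · have hterm (c : ℕ) : (if (r : ℕ) = 2 * c then (1 : ℝ)/2
        else if (r : ℕ) = 2 * c + 1 then 1
        else if (r : ℕ) = 2 * c + 2 then (1 : ℝ)/2 else 0) * Real.sin (2 * θ * (c + 1)) =
        if m = c then Real.sin (2 * θ * (m + 1)) else 0 := by
      rcases eq_or_ne m c with rfl | h1
      · simp [hm]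
      · rw [if_neg (by omega), if_neg (by omega), if_neg (by omega), if_neg h1, zero_mul]
    rw [Finset.sum_congr rfl fun c _ => hterm c, Finset.sum_ite_eq,
      if_pos (Finset.mem_range.2 (by omega)), sineMode, hm, Odd.neg_one_pow ⟨m, rfl⟩]
    push_cast
    rw [show θ * (2 * (m : ℝ) + 1 + 1) = 2 * θ * (m + 1) by ring]
    linear_combination -Real.sin (2 * θ * (m + 1)) * hone

theorem IsInterpolation.transpose_mulVec_sineMode {N n : ℕ} {P : Matrix (Fin N) (Fin n) ℝ}
    (hP : IsInterpolation P) (hN : N = 2 * n + 1) (θ : ℝ) :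
    (((1 : ℝ) / 2) • Pᵀ) *ᵥ sineMode N θ = Real.cos (θ / 2) ^ 2 • sineMode n (2 * θ) := by
  ext c
  have hcos : Real.cos θ = 2 * Real.cos (θ / 2) ^ 2 - 1 := by
    rw [← Real.cos_two_mul, mul_div_cancel₀ _ two_ne_zero]
  have hsum : (Pᵀ *ᵥ sineMode N θ) c = ∑ r ∈ Finset.range N,
      ((if r = 2 * (c : ℕ) then 1 / 2 * Real.sin (θ * (2 * (c : ℕ) + 1)) else 0) +
       (if r = 2 * (c : ℕ) + 1 then Real.sin (θ * (2 * (c : ℕ) + 2)) else 0) +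
       (if r = 2 * (c : ℕ) + 2 then 1 / 2 * Real.sin (θ * (2 * (c : ℕ) + 3)) else 0)) := by
    rw [Finset.sum_range]
    simp only [mulVec, dotProduct, transpose_apply, hP _ c, sineMode]
    refine Finset.sum_congr rfl fun r _ => ?_
    by_cases h1 : (r : ℕ) = 2 * (c : ℕ)
    · simp [h1]
    by_cases h2 : (r : ℕ) = 2 * (c : ℕ) + 1
    · simp [h2]
      ring_nf
    by_cases h3 : (r : ℕ) = 2 * (c : ℕ) + 2
    · simp [h3]
      ring_nf
    · simp [h1, h2, h3]
  have hc := c.2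
  rw [smul_mulVec, Pi.smul_apply, hsum]
  simp only [Finset.sum_add_distrib, Finset.sum_ite_eq', Finset.mem_range]
  rw [if_pos (by omega), if_pos (by omega), if_pos (by omega)]
  simp only [Pi.smul_apply, smul_eq_mul, sineMode]
  rw [show θ * (2 * ((c : ℕ) : ℝ) + 1) = 2 * θ * ((c : ℕ) + 1) - θ by ring,
    show θ * (2 * ((c : ℕ) : ℝ) + 2) = 2 * θ * ((c : ℕ) + 1) by ring,
    show θ * (2 * ((c : ℕ) : ℝ) + 3) = 2 * θ * ((c : ℕ) + 1) + θ by ring,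
    Real.sin_add, Real.sin_sub, hcos]
  ring

theorem sineMode_two_mul_pi_sub (n : ℕ) (θ : ℝ) :
    sineMode n (2 * (π - θ)) = -sineMode n (2 * θ) := by
  ext i
  rw [Pi.neg_apply, sineMode, sineMode, ← Real.sin_neg,
    show 2 * (π - θ) * (((i : ℕ) : ℝ) + 1) =
      -(2 * θ * ((i : ℕ) + 1)) + ((i + 1 : ℕ) : ℝ) * (2 * π) by push_cast; ring,
    Real.sin_add_nat_mul_two_pi]

theorem IsInterpolation.transpose_mulVec_sineMode_pi_sub {N n : ℕ}
    {P : Matrix (Fin N) (Fin n) ℝ} (hP : IsInterpolation P) (hN : N = 2 * n + 1) (θ : ℝ) :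
    (((1 : ℝ) / 2) • Pᵀ) *ᵥ sineMode N (π - θ) =
      -(Real.sin (θ / 2) ^ 2 • sineMode n (2 * θ)) := by
  rw [hP.transpose_mulVec_sineMode hN, sineMode_two_mul_pi_sub, smul_neg, sub_div,
    Real.cos_pi_div_two_sub]

/-- The columns `(v, 0)` and `(0, v)`. -/
def twoCopies {n : ℕ} (v : Fin n → ℝ) : Matrix (Fin n ⊕ Fin n) (Fin 2) ℝ :=
  of (Sum.elim (fun i => ![v i, 0]) (fun i => ![0, v i]))

theorem twoCopies_mulVec {n : ℕ} (v : Fin n → ℝ) (w : Fin 2 → ℝ) :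
    twoCopies v *ᵥ w = Sum.elim (w 0 • v) (w 1 • v) := by
  ext (i | i) <;> simp [twoCopies, mulVec, dotProduct, mul_comm]

/-- A matrix that acts invertibly on two copies of each vector of a basis is invertible. -/
theorem isUnit_of_mul_twoCopies {n : ℕ} {A : Matrix (Fin n ⊕ Fin n) (Fin n ⊕ Fin n) ℝ}
    {φ : Fin n → Fin n → ℝ} (hφ : LinearIndependent ℝ φ)
    {L : Fin n → Matrix (Fin 2) (Fin 2) ℝ} (hL : ∀ k, IsUnit (L k).det)
    (hA : ∀ k, A * twoCopies (φ k) = twoCopies (φ k) * L k) : IsUnit A := by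
  rw [← mulVec_surjective_iff_isUnit]
  have hmem (k : Fin n) (w : Fin 2 → ℝ) :
      twoCopies (φ k) *ᵥ w ∈ LinearMap.range A.mulVecLin := by
    refine ⟨twoCopies (φ k) *ᵥ ((L k)⁻¹ *ᵥ w), ?_⟩
    rw [mulVecLin_apply, mulVec_mulVec, hA, ← mulVec_mulVec, mulVec_mulVec _ (L k),
      mul_nonsing_inv _ (hL k), one_mulVec]
  have hspan := hφ.span_eq_top_of_card_eq_finrank' (by simp)
  have hmem' (v : Fin n → ℝ) (w : Fin 2 → ℝ) :
      twoCopies v *ᵥ w ∈ LinearMap.range A.mulVecLin := by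
    have hv : v ∈ Submodule.span ℝ (Set.range φ) := hspan ▸ Submodule.mem_top
    induction hv using Submodule.span_induction with
    | mem x hx =>
      obtain ⟨k, rfl⟩ := hx
      exact hmem k w
    | zero =>
      convert Submodule.zero_mem (LinearMap.range A.mulVecLin) using 1
      ext (i | i) <;> simp [twoCopies_mulVec]
    | add x y _ _ hx hy =>
      convert Submodule.add_mem _ hx hy using 1
      ext (i | i) <;> simp [twoCopies_mulVec]
    | smul a x _ hx =>
      convert Submodule.smul_mem _ a hx using 1
      ext (i | i) <;> simp [twoCopies_mulVec, mul_left_comm]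
  intro v
  obtain ⟨w, hw⟩ := Submodule.add_mem _ (hmem' (v ∘ Sum.inl) ![1, 0])
    (hmem' (v ∘ Sum.inr) ![0, 1])
  refine ⟨w, ?_⟩
  rw [← mulVecLin_apply, hw, twoCopies_mulVec, twoCopies_mulVec]
  ext (i | i) <;> simp

/-- The columns `(v, 0)`, `(w, 0)`, `(0, v)` and `(0, w)`. -/
def pairCopies {n : ℕ} (v w : Fin n → ℝ) : Matrix (Fin n ⊕ Fin n) (Fin 4) ℝ :=
  of (Sum.elim (fun i => ![v i, w i, 0, 0]) (fun i => ![0, 0, v i, w i]))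

theorem fromBlocks_zero_mul_twoCopies {N n : ℕ} {P : Matrix (Fin N) (Fin n) ℝ}
    {u : Fin n → ℝ} {v w : Fin N → ℝ} {a b : ℝ} (hP : P *ᵥ u = a • v - b • w) :
    fromBlocks P 0 0 P * twoCopies u = pairCopies v w * !![a, 0; -b, 0; 0, a; 0, -b] := by
  ext (i | i) j <;> fin_cases j <;>
    have := congrFun hP i <;>
    simp [mul_apply, twoCopies, pairCopies, Fin.sum_univ_four, mulVec, dotProduct] at this ⊢ <;>
    linarith

theorem fromBlocks_zero_mul_pairCopies {N n : ℕ} {R : Matrix (Fin n) (Fin N) ℝ}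
    {u : Fin n → ℝ} {v w : Fin N → ℝ} {a b : ℝ} (hv : R *ᵥ v = a • u) (hw : R *ᵥ w = -(b • u)) :
    fromBlocks R 0 0 R * pairCopies v w =
      twoCopies u * (!![a, 0; -b, 0; 0, a; 0, -b] : Matrix (Fin 4) (Fin 2) ℝ)ᵀ := by
  ext (i | i) j <;> fin_cases j <;>
    have hvi := congrFun hv i <;>
    have hwi := congrFun hw i <;>
    simp [mul_apply, twoCopies, pairCopies, Fin.sum_univ_two, mulVec, dotProduct] at hvi hwi ⊢ <;>
    linarith

theorem antidiagonal_mul_pairCopies {n : ℕ} {G₁ G₂ : Matrix (Fin n) (Fin n) ℝ}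
    {v w : Fin n → ℝ} {a₁ a₂ b₁ b₂ : ℝ}
    (hv₁ : G₁ *ᵥ v = a₁ • v) (hv₂ : G₂ *ᵥ v = a₂ • v)
    (hw₁ : G₁ *ᵥ w = b₁ • w) (hw₂ : G₂ *ᵥ w = b₂ • w) :
    fromBlocks 0 G₁ G₂ 0 * pairCopies v w =
      pairCopies v w * !![0, 0, a₁, 0; 0, 0, 0, b₁; a₂, 0, 0, 0; 0, b₂, 0, 0] := by
  ext (i | i) j <;> fin_cases j <;>
    have h1 := congrFun hv₁ i <;>
    have h2 := congrFun hv₂ i <;>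
    have h3 := congrFun hw₁ i <;>
    have h4 := congrFun hw₂ i <;>
    simp [mul_apply, pairCopies, Fin.sum_univ_four, mulVec, dotProduct] at h1 h2 h3 h4 ⊢ <;>
    linarith

theorem antidiagonal_sq (a₁ a₂ b₁ b₂ : ℝ) :
    (!![0, 0, a₁, 0; 0, 0, 0, b₁; a₂, 0, 0, 0; 0, b₂, 0, 0] : Matrix (Fin 4) (Fin 4) ℝ) ^ 2 =
      diagonal ![a₁ * a₂, b₁ * b₂, a₁ * a₂, b₁ * b₂] := by
  ext i j
  fin_cases i <;> fin_cases j <;> simp [pow_two, mul_apply, Fin.sum_univ_four, mul_comm]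

theorem antidiagonal_pow_even (a₁ a₂ b₁ b₂ : ℝ) (m : ℕ) :
    (!![0, 0, a₁, 0; 0, 0, 0, b₁; a₂, 0, 0, 0; 0, b₂, 0, 0] : Matrix (Fin 4) (Fin 4) ℝ) ^ (2 * m) =
      diagonal ![(a₁ * a₂) ^ m, (b₁ * b₂) ^ m, (a₁ * a₂) ^ m, (b₁ * b₂) ^ m] := by
  rw [pow_mul, antidiagonal_sq, diagonal_pow]
  congr 1
  ext i
  fin_cases i <;> rfl

theorem antidiagonal_pow_odd (a₁ a₂ b₁ b₂ : ℝ) (m : ℕ) :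
    (!![0, 0, a₁, 0; 0, 0, 0, b₁; a₂, 0, 0, 0; 0, b₂, 0, 0] : Matrix (Fin 4) (Fin 4) ℝ) ^
        (2 * m + 1) =
      !![0, 0, a₁ ^ (m + 1) * a₂ ^ m, 0; 0, 0, 0, b₁ ^ (m + 1) * b₂ ^ m;
         a₁ ^ m * a₂ ^ (m + 1), 0, 0, 0; 0, b₁ ^ m * b₂ ^ (m + 1), 0, 0] := by
  rw [pow_succ, antidiagonal_pow_even]
  ext i j
  fin_cases i <;> fin_cases j <;> simp [diagonal_mul] <;> ring

theorem pow_mul_eq_mul_pow {m n : Type*} [Fintype m] [DecidableEq m] [Fintype n] [DecidableEq n]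
    {A : Matrix m m ℝ} {B : Matrix n n ℝ} {M : Matrix m n ℝ} (h : A * M = M * B) (p : ℕ) :
    A ^ p * M = M * B ^ p := by
  induction p with
  | zero => simp
  | succ p ih => rw [pow_succ, Matrix.mul_assoc, h, ← Matrix.mul_assoc, ih, Matrix.mul_assoc,
      ← pow_succ]

/-- The Galerkin symbol is invertible when the smoothing symbols lie in `[0, 1)`. -/
theorem isUnit_det_galerkin_symbol {a b p₁ p₂ q₁ q₂ : ℝ} (hab : a + b = 1)
    (hp₁ : 0 ≤ p₁ ∧ p₁ < 1) (hp₂ : 0 ≤ p₂ ∧ p₂ < 1) (hq₁ : 0 ≤ q₁ ∧ q₁ < 1)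
    (hq₂ : 0 ≤ q₂ ∧ q₂ < 1) :
    IsUnit ((!![a, 0; -b, 0; 0, a; 0, -b] : Matrix (Fin 4) (Fin 2) ℝ)ᵀ *
      !![1, 0, -p₁, 0; 0, 1, 0, -q₁; -p₂, 0, 1, 0; 0, -q₂, 0, 1] *
      !![a, 0; -b, 0; 0, a; 0, -b]).det := by
  have hdet : ((!![a, 0; -b, 0; 0, a; 0, -b] : Matrix (Fin 4) (Fin 2) ℝ)ᵀ *
      !![1, 0, -p₁, 0; 0, 1, 0, -q₁; -p₂, 0, 1, 0; 0, -q₂, 0, 1] *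
      !![a, 0; -b, 0; 0, a; 0, -b]).det =
      (a ^ 2 + b ^ 2) * (a ^ 2 + b ^ 2) -
        (a ^ 2 * p₁ + b ^ 2 * q₁) * (a ^ 2 * p₂ + b ^ 2 * q₂) := by
    simp [det_fin_two, mul_apply, Fin.sum_univ_four]
    ring
  have hs : 0 < a ^ 2 + b ^ 2 := by nlinarith [sq_nonneg (a - b)]
  have hlt {p q : ℝ} (hp : p < 1) (hq : q < 1) : a ^ 2 * p + b ^ 2 * q < a ^ 2 + b ^ 2 := by
    rcases (sq_nonneg a).eq_or_lt with ha | ha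
    · rw [← ha] at hs ⊢
      nlinarith
    · nlinarith [mul_le_mul_of_nonneg_left hq.le (sq_nonneg b), mul_lt_mul_of_pos_left hp ha]
  have hnonneg {p q : ℝ} (hp : 0 ≤ p) (hq : 0 ≤ q) : 0 ≤ a ^ 2 * p + b ^ 2 * q := by positivity
  rw [hdet, isUnit_iff_ne_zero]
  exact (sub_pos.2 (mul_lt_mul'' (hlt hp₁.2 hq₁.2) (hlt hp₂.2 hq₂.2)
    (hnonneg hp₁.1 hq₁.1) (hnonneg hp₂.1 hq₂.1))).ne'

theorem stmt10
    (l : ℕ) (hl : 2 ≤ l)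
    (Nc Nh : ℕ) (hNc : Nc = 2 ^ (l - 1) - 1) (hNh : Nh = 2 * Nc + 1)
    (h : ℝ) (hh : h = 1 / ((Nh : ℝ) + 1))
    (ψ : ℕ → Fin Nh → ℝ)
    (hψ : ∀ (k : ℕ) (j : Fin Nh), ψ k j = Real.sin (k * Real.pi * h * ((j : ℕ) + 1)))
    (Pt : Matrix (Fin Nh) (Fin Nc) ℝ)
    (hPt : ∀ (r : Fin Nh) (c : Fin Nc),
      Pt r c = if (r : ℕ) = 2 * (c : ℕ) then (1 : ℝ)/2
        else if (r : ℕ) = 2 * (c : ℕ) + 1 then 1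
        else if (r : ℕ) = 2 * (c : ℕ) + 2 then (1 : ℝ)/2 else 0)
    (Rt : Matrix (Fin Nc) (Fin Nh) ℝ) (hRt : Rt = ((1 : ℝ)/2) • Ptᵀ)
    (ρ₁ ρ₂ : ℕ → ℝ)
    (G₁ G₂ : Matrix (Fin Nh) (Fin Nh) ℝ)
    (hG₁ : ∀ k : ℕ, 1 ≤ k → k ≤ Nh → G₁.mulVec (ψ k) = ρ₁ k • ψ k)
    (hG₂ : ∀ k : ℕ, 1 ≤ k → k ≤ Nh → G₂.mulVec (ψ k) = ρ₂ k • ψ k)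
    (Gh : Matrix (Fin Nh ⊕ Fin Nh) (Fin Nh ⊕ Fin Nh) ℝ)
    (hGh : Gh = Matrix.fromBlocks 0 G₁ G₂ 0)
    (Ah : Matrix (Fin Nh ⊕ Fin Nh) (Fin Nh ⊕ Fin Nh) ℝ)
    (hAh : Ah = Matrix.fromBlocks 1 (-G₁) (-G₂) 1)
    (P2h : Matrix (Fin Nh ⊕ Fin Nh) (Fin Nc ⊕ Fin Nc) ℝ)
    (hP2h : P2h = Matrix.fromBlocks Pt 0 0 Pt)
    (R2h : Matrix (Fin Nc ⊕ Fin Nc) (Fin Nh ⊕ Fin Nh) ℝ)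
    (hR2h : R2h = Matrix.fromBlocks Rt 0 0 Rt)
    (A2h : Matrix (Fin Nc ⊕ Fin Nc) (Fin Nc ⊕ Fin Nc) ℝ)
    (hA2h : A2h = R2h * Ah * P2h)
    (n₁ n₂ : ℕ)
    (Th : Matrix (Fin Nh ⊕ Fin Nh) (Fin Nh ⊕ Fin Nh) ℝ)
    (hTh : Th = Gh ^ n₂ * (1 - P2h * A2h⁻¹ * R2h * Ah) * Gh ^ n₁)
    (V : ℕ → Matrix (Fin 4) (Fin 2) ℝ)
    (hV : ∀ k : ℕ, V k =
      !![(Real.cos (k * Real.pi * h / 2))^2, 0;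
         -(Real.sin (k * Real.pi * h / 2))^2, 0;
         0, (Real.cos (k * Real.pi * h / 2))^2;
         0, -(Real.sin (k * Real.pi * h / 2))^2])
    (Hm : ℕ → Matrix (Fin 4) (Fin 4) ℝ)
    (hHm : ∀ k : ℕ, Hm k =
      !![1, 0, -ρ₁ k, 0;
         0, 1, 0, -ρ₁ (Nh - k + 1);
         -ρ₂ k, 0, 1, 0;
         0, -ρ₂ (Nh - k + 1), 0, 1])
    (D : ℕ → ℕ → Matrix (Fin 4) (Fin 4) ℝ)
    (hDeven : ∀ (k n : ℕ), Even n → D k n =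
      Matrix.diagonal ![(Real.sqrt (ρ₁ k * ρ₂ k)) ^ n,
        (Real.sqrt (ρ₁ (Nh - k + 1) * ρ₂ (Nh - k + 1))) ^ n,
        (Real.sqrt (ρ₁ k * ρ₂ k)) ^ n,
        (Real.sqrt (ρ₁ (Nh - k + 1) * ρ₂ (Nh - k + 1))) ^ n])
    (hDodd : ∀ (k n : ℕ), Odd n → D k n =
      !![0, 0, ρ₁ k ^ ((n+1)/2) * ρ₂ k ^ ((n-1)/2), 0;
         0, 0, 0, ρ₁ (Nh - k + 1) ^ ((n+1)/2) * ρ₂ (Nh - k + 1) ^ ((n-1)/2);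
         ρ₁ k ^ ((n-1)/2) * ρ₂ k ^ ((n+1)/2), 0, 0, 0;
         0, ρ₁ (Nh - k + 1) ^ ((n-1)/2) * ρ₂ (Nh - k + 1) ^ ((n+1)/2), 0, 0])
    (Λ₁ : ℕ → Matrix (Fin 2) (Fin 4) ℝ) (hΛ₁ : ∀ k : ℕ, Λ₁ k = (V k)ᵀ * Hm k * D k n₁)
    (Λ₂ : ℕ → Matrix (Fin 2) (Fin 2) ℝ) (hΛ₂ : ∀ k : ℕ, Λ₂ k = (V k)ᵀ * Hm k * V k)
    (M : ℕ → Matrix (Fin Nh ⊕ Fin Nh) (Fin 4) ℝ)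
    (hM : ∀ (k : ℕ) (j : Fin Nh),
      M k (Sum.inl j) = ![ψ k j, ψ (Nh - k + 1) j, 0, 0] ∧
      M k (Sum.inr j) = ![0, 0, ψ k j, ψ (Nh - k + 1) j])
    (hρ₁ : ∀ k : ℕ, 1 ≤ k → k ≤ Nh → 0 ≤ ρ₁ k ∧ ρ₁ k < 1)
    (hρ₂ : ∀ k : ℕ, 1 ≤ k → k ≤ Nh → 0 ≤ ρ₂ k ∧ ρ₂ k < 1)
    (hmono₁ : ∀ k : ℕ, 1 ≤ k → k ≤ Nc → ρ₁ (Nh - k + 1) ≤ ρ₁ k)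
    (hmono₂ : ∀ k : ℕ, 1 ≤ k → k ≤ Nc → ρ₂ (Nh - k + 1) ≤ ρ₂ k) :
    ∀ k : ℕ, 1 ≤ k → k ≤ Nc →
      Th * M k = M k * (D k n₂ * (D k n₁ - V k * (Λ₂ k)⁻¹ * Λ₁ k)) := by
  have hh' : (2 * ((Nc : ℝ) + 1)) * h = 1 := by
    have hpos : (Nh : ℝ) + 1 ≠ 0 := by positivity
    rw [show 2 * ((Nc : ℝ) + 1) = Nh + 1 by rw [hNh]; push_cast; ring, hh]
    field_simp
  have hψ_sine (k : ℕ) : ψ k = sineMode Nh (k * π * h) := funext fun j => hψ k j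
  have hψ_refl (k : ℕ) (hk : k ≤ Nc) : ψ (Nh - k + 1) = sineMode Nh (π - k * π * h) := by
    rw [hψ_sine, hNh]
    congr 1
    rw [Nat.cast_add, Nat.cast_sub (by omega)]
    push_cast
    linear_combination π * hh'
  have hM_pair (k : ℕ) : M k = pairCopies (ψ k) (ψ (Nh - k + 1)) := by
    ext (j | j) i
    · rw [(hM k j).1]; rfl
    · rw [(hM k j).2]; rfl
  have hGM (k : ℕ) (hk : 1 ≤ k) (hk' : k ≤ Nc) :
      Gh * M k = M k * !![0, 0, ρ₁ k, 0; 0, 0, 0, ρ₁ (Nh - k + 1);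
        ρ₂ k, 0, 0, 0; 0, ρ₂ (Nh - k + 1), 0, 0] := by
    rw [hGh, hM_pair]
    exact antidiagonal_mul_pairCopies (hG₁ k hk (by omega)) (hG₂ k hk (by omega))
      (hG₁ _ (by omega) (by omega)) (hG₂ _ (by omega) (by omega))
  have hGpow (k : ℕ) (hk : 1 ≤ k) (hk' : k ≤ Nc) (n : ℕ) : Gh ^ n * M k = M k * D k n := by
    rw [pow_mul_eq_mul_pow (hGM k hk hk')]
    congr 1
    obtain ⟨m, rfl | rfl⟩ := Nat.even_or_odd' n
    · have hp : 0 ≤ ρ₁ k * ρ₂ k :=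
        mul_nonneg (hρ₁ k hk (by omega)).1 (hρ₂ k hk (by omega)).1
      have hq : 0 ≤ ρ₁ (Nh - k + 1) * ρ₂ (Nh - k + 1) :=
        mul_nonneg (hρ₁ _ (by omega) (by omega)).1 (hρ₂ _ (by omega) (by omega)).1
      rw [hDeven k _ (even_two_mul m), antidiagonal_pow_even, pow_mul, pow_mul,
        Real.sq_sqrt hp, Real.sq_sqrt hq]
    · rw [hDodd k _ ⟨m, rfl⟩, antidiagonal_pow_odd, show (2 * m + 1 + 1) / 2 = m + 1 by omega,
        show (2 * m + 1 - 1) / 2 = m by omega]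
  have hAM (k : ℕ) (hk : 1 ≤ k) (hk' : k ≤ Nc) : Ah * M k = M k * Hm k := by
    have hA : Ah = 1 - Gh := by
      rw [hAh, hGh, ← fromBlocks_one, sub_eq_add_neg, fromBlocks_neg, fromBlocks_add]
      simp
    have hH : Hm k = 1 - !![0, 0, ρ₁ k, 0; 0, 0, 0, ρ₁ (Nh - k + 1);
        ρ₂ k, 0, 0, 0; 0, ρ₂ (Nh - k + 1), 0, 0] := by
      rw [hHm]
      ext i j
      fin_cases i <;> fin_cases j <;> simp
    rw [hA, hH, Matrix.sub_mul, hGM k hk hk', Matrix.mul_sub, Matrix.one_mul, Matrix.mul_one]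
  have hP : IsInterpolation Pt := hPt
  have hPΦ (k : ℕ) (hk' : k ≤ Nc) :
      P2h * twoCopies (sineMode Nc (2 * (k * π * h))) = M k * V k := by
    rw [hP2h, hM_pair, hV, hψ_refl k hk', hψ_sine]
    refine fromBlocks_zero_mul_twoCopies (hP.mulVec_sineMode hNh ?_)
    rw [show 2 * (k * π * h) * ((Nc : ℝ) + 1) = k * π by linear_combination k * π * hh']
    exact Real.sin_nat_mul_pi k
  have hRM (k : ℕ) (hk' : k ≤ Nc) :
      R2h * M k = twoCopies (sineMode Nc (2 * (k * π * h))) * (V k)ᵀ := by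
    rw [hR2h, hM_pair, hV, hψ_refl k hk', hψ_sine, hRt]
    exact fromBlocks_zero_mul_pairCopies (hP.transpose_mulVec_sineMode hNh _)
      (hP.transpose_mulVec_sineMode_pi_sub hNh _)
  have hAΦ (k : ℕ) (hk : 1 ≤ k) (hk' : k ≤ Nc) :
      A2h * twoCopies (sineMode Nc (2 * (k * π * h))) =
        twoCopies (sineMode Nc (2 * (k * π * h))) * Λ₂ k := by
    rw [hA2h, Matrix.mul_assoc, hPΦ k hk', Matrix.mul_assoc, ← Matrix.mul_assoc Ah,
      hAM k hk hk', Matrix.mul_assoc (M k), ← Matrix.mul_assoc R2h, hRM k hk', hΛ₂]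
    simp only [Matrix.mul_assoc]
  have hΛ (k : ℕ) (hk : 1 ≤ k) (hk' : k ≤ Nc) : IsUnit (Λ₂ k).det := by
    rw [hΛ₂, hV, hHm]
    exact isUnit_det_galerkin_symbol (Real.cos_sq_add_sin_sq _)
      (hρ₁ k hk (by omega)) (hρ₂ k hk (by omega))
      (hρ₁ _ (by omega) (by omega)) (hρ₂ _ (by omega) (by omega))
  have hA : IsUnit A2h.det := by
    rw [← isUnit_iff_isUnit_det]
    refine isUnit_of_mul_twoCopies (sineMode_linearIndependent Nc)
      (L := fun k => Λ₂ ((k : ℕ) + 1)) (fun k => hΛ _ (by omega) (by omega)) fun k => ?_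
    have hangle : 2 * (((k + 1 : ℕ) : ℝ) * π * h) = ((k : ℕ) + 1 : ℝ) * π / (Nc + 1) := by
      rw [eq_div_iff (by positivity)]
      push_cast
      linear_combination ((k : ℕ) + 1 : ℝ) * π * hh'
    rw [← hangle]
    exact hAΦ _ (by omega) (by omega)
  intro k hk hk'
  have hinv : A2h⁻¹ * twoCopies (sineMode Nc (2 * (k * π * h))) =
      twoCopies (sineMode Nc (2 * (k * π * h))) * (Λ₂ k)⁻¹ := by
    set Φ := twoCopies (sineMode Nc (2 * (k * π * h)))
    calc A2h⁻¹ * Φ = A2h⁻¹ * (Φ * Λ₂ k) * (Λ₂ k)⁻¹ := by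
          rw [Matrix.mul_assoc, mul_nonsing_inv_cancel_right _ _ (hΛ k hk hk')]
      _ = Φ * (Λ₂ k)⁻¹ := by
          rw [← hAΦ k hk hk', nonsing_inv_mul_cancel_left _ _ hA]
  have hcorr : P2h * A2h⁻¹ * R2h * Ah * M k = M k * (V k * (Λ₂ k)⁻¹ * ((V k)ᵀ * Hm k)) := by
    calc P2h * A2h⁻¹ * R2h * Ah * M k = P2h * (A2h⁻¹ * (R2h * M k)) * Hm k := by
          rw [Matrix.mul_assoc _ Ah, hAM k hk hk']
          simp only [Matrix.mul_assoc]
      _ = P2h * twoCopies (sineMode Nc (2 * (k * π * h))) * (Λ₂ k)⁻¹ * (V k)ᵀ * Hm k := by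
          rw [hRM k hk', ← Matrix.mul_assoc A2h⁻¹, hinv]
          simp only [Matrix.mul_assoc]
      _ = M k * (V k * (Λ₂ k)⁻¹ * ((V k)ᵀ * Hm k)) := by
          rw [hPΦ k hk']
          simp only [Matrix.mul_assoc]
  calc Th * M k = Gh ^ n₂ * ((1 - P2h * A2h⁻¹ * R2h * Ah) * M k * D k n₁) := by
        rw [hTh, Matrix.mul_assoc, hGpow k hk hk']
        simp only [Matrix.mul_assoc]
    _ = Gh ^ n₂ * M k * (D k n₁ - V k * (Λ₂ k)⁻¹ * Λ₁ k) := by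
        rw [Matrix.sub_mul, hcorr, hΛ₁]
        simp only [Matrix.mul_assoc, Matrix.sub_mul, Matrix.mul_sub, Matrix.one_mul]
    _ = M k * (D k n₂ * (D k n₁ - V k * (Λ₂ k)⁻¹ * Λ₁ k)) := by
        rw [hGpow k hk hk', Matrix.mul_assoc]
end

section
/- The following identities hold: T̃ T̃ᵀ = I_{N^s}, A_s T̃ = T̃ D A_a, and G_s T̃ = T̃ G_a. -/
open Matrix

theorem stmt13
    (N1a N2a N1 N2 : ℕ) (hN1a : 0 < N1a) (hN2a : 0 < N2a) (hN1 : 0 < N1) (hN2 : 0 < N2)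
    (A₁ : Matrix (Fin N1a) (Fin N1a) ℝ) (A₂ : Matrix (Fin N2a) (Fin N2a) ℝ)
    (hA₁ : IsUnit A₁) (hA₂ : IsUnit A₂)
    (E₁ : Matrix (Fin N1a) (Fin N1) ℝ) (E₂ : Matrix (Fin N2a) (Fin N2) ℝ)
    (R₁ : Matrix (Fin N1) (Fin N2a) ℝ) (R₂ : Matrix (Fin N2) (Fin N1a) ℝ)
    (hR₁ : R₁ * R₁ᵀ = 1) (hR₂ : R₂ * R₂ᵀ = 1)
    (Aa : Matrix (Fin N1a ⊕ Fin N2a) (Fin N1a ⊕ Fin N2a) ℝ)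
    (hAa : Aa = Matrix.fromBlocks A₁ (E₁ * R₁) (E₂ * R₂) A₂)
    (As : Matrix (Fin N2 ⊕ Fin N1) (Fin N2 ⊕ Fin N1) ℝ)
    (hAs : As = Matrix.fromBlocks 1 (R₂ * A₁⁻¹ * E₁) (R₁ * A₂⁻¹ * E₂) 1)
    (Ga : Matrix (Fin N1a ⊕ Fin N2a) (Fin N1a ⊕ Fin N2a) ℝ)
    (hGa : Ga = Matrix.fromBlocks 0 (-(A₁⁻¹ * E₁ * R₁)) (-(A₂⁻¹ * E₂ * R₂)) 0)
    (Gs : Matrix (Fin N2 ⊕ Fin N1) (Fin N2 ⊕ Fin N1) ℝ)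
    (hGs : Gs = Matrix.fromBlocks 0 (-(R₂ * A₁⁻¹ * E₁)) (-(R₁ * A₂⁻¹ * E₂)) 0)
    (Tt : Matrix (Fin N2 ⊕ Fin N1) (Fin N1a ⊕ Fin N2a) ℝ)
    (hTt : Tt = Matrix.fromBlocks R₂ 0 0 R₁)
    (D : Matrix (Fin N1a ⊕ Fin N2a) (Fin N1a ⊕ Fin N2a) ℝ)
    (hD : D = Matrix.fromBlocks A₁⁻¹ 0 0 A₂⁻¹) :
    Tt * Ttᵀ = 1 ∧ As * Tt = Tt * D * Aa ∧ Gs * Tt = Tt * Ga := by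
  have h₁ : A₁⁻¹ * A₁ = 1 := nonsing_inv_mul A₁ ((isUnit_iff_isUnit_det A₁).mp hA₁)
  have h₂ : A₂⁻¹ * A₂ = 1 := nonsing_inv_mul A₂ ((isUnit_iff_isUnit_det A₂).mp hA₂)
  subst hAa hAs hGa hGs hTt hD
  refine ⟨?_, ?_, ?_⟩
  · simp [fromBlocks_transpose, fromBlocks_multiply, hR₁, hR₂]
  · simp [fromBlocks_multiply, Matrix.mul_assoc, h₁, h₂]
  · simp [fromBlocks_multiply, Matrix.mul_assoc]
end

section
/- Assume in addition that E₁ᵀE₁ = I_{N₁} and E₂ᵀE₂ = I_{N₂}. Then the matrices G_s ∈ ℝ^{N^s×N^s} and G_a ∈ ℝ^{N^a×N^a} have the same nonzero eigenvalues: for every complex number λ ≠ 0, λ is an eigenvalue of (the complexification of) G_s if and only if λ is an eigenvalue of (the complexification of) G_a. -/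
open Matrix

/-- For rectangular matrices over a field, `M * N` and `N * M` have the same nonzero spectrum. -/
theorem Matrix.mem_spectrum_mul_comm_of_ne_zero {K m n : Type*} [Field K]
    [Fintype m] [DecidableEq m] [Fintype n] [DecidableEq n]
    (M : Matrix m n K) (N : Matrix n m K) {a : K} (ha : a ≠ 0) :
    a ∈ spectrum K (M * N) ↔ a ∈ spectrum K (N * M) := by
  have h := congrArg (Polynomial.eval a) (Matrix.charpoly_mul_comm' M N)
  simp only [Polynomial.eval_mul, Polynomial.eval_pow, Polynomial.eval_X] at h
  rw [Matrix.mem_spectrum_iff_isRoot_charpoly, Matrix.mem_spectrum_iff_isRoot_charpoly,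
    Polynomial.IsRoot, Polynomial.IsRoot,
    ← mul_eq_zero_iff_left (pow_ne_zero (Fintype.card n) ha), h,
    mul_eq_zero_iff_left (pow_ne_zero (Fintype.card m) ha)]

theorem stmt14
    (N1a N2a N1 N2 : ℕ) (hN1a : 0 < N1a) (hN2a : 0 < N2a) (hN1 : 0 < N1) (hN2 : 0 < N2)
    (A₁ : Matrix (Fin N1a) (Fin N1a) ℝ) (A₂ : Matrix (Fin N2a) (Fin N2a) ℝ)
    (hA₁ : IsUnit A₁) (hA₂ : IsUnit A₂)
    (E₁ : Matrix (Fin N1a) (Fin N1) ℝ) (E₂ : Matrix (Fin N2a) (Fin N2) ℝ)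
    (R₁ : Matrix (Fin N1) (Fin N2a) ℝ) (R₂ : Matrix (Fin N2) (Fin N1a) ℝ)
    (hR₁ : R₁ * R₁ᵀ = 1) (hR₂ : R₂ * R₂ᵀ = 1)
    (hE₁ : E₁ᵀ * E₁ = 1) (hE₂ : E₂ᵀ * E₂ = 1)
    (Ga : Matrix (Fin N1a ⊕ Fin N2a) (Fin N1a ⊕ Fin N2a) ℝ)
    (hGa : Ga = Matrix.fromBlocks 0 (-(A₁⁻¹ * E₁ * R₁)) (-(A₂⁻¹ * E₂ * R₂)) 0)
    (Gs : Matrix (Fin N2 ⊕ Fin N1) (Fin N2 ⊕ Fin N1) ℝ)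
    (hGs : Gs = Matrix.fromBlocks 0 (-(R₂ * A₁⁻¹ * E₁)) (-(R₁ * A₂⁻¹ * E₂)) 0) :
    ∀ lam : ℂ, lam ≠ 0 →
      (lam ∈ spectrum ℂ (Gs.map (algebraMap ℝ ℂ)) ↔
        lam ∈ spectrum ℂ (Ga.map (algebraMap ℝ ℂ))) := by
  intro lam hlam
  have hs : Gs = fromBlocks R₂ 0 0 R₁ * fromBlocks 0 (-(A₁⁻¹ * E₁)) (-(A₂⁻¹ * E₂)) 0 := by
    simp [hGs, fromBlocks_multiply, Matrix.mul_assoc]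
  have ha : Ga = fromBlocks 0 (-(A₁⁻¹ * E₁)) (-(A₂⁻¹ * E₂)) 0 * fromBlocks R₂ 0 0 R₁ := by
    simp [hGa, fromBlocks_multiply]
  rw [hs, ha, Matrix.map_mul, Matrix.map_mul]
  exact Matrix.mem_spectrum_mul_comm_of_ne_zero _ _ hlam
end

section
/- Let P_s ∈ ℝ^{N^s×M} with R_s = P_sᵀ, and assume R_sA_sP_s is invertible. Define the substructured two-level iteration matrix G_s^{2L} = [I_{N^s} − P_s(R_sA_sP_s)^{-1}R_sA_s]G_s, and set P_a = T̃ᵀP_s, R_a = R_sT̃, and G_a^{2L} = [I_{N^a} − P_a(R_aDA_aP_a)^{-1}R_aDA_a]G_a (the matrix R_aDA_aP_a equals R_sA_sP_s, hence is invertible). Then the intertwining relation G_s^{2L} T̃ = T̃ G_a^{2L} holds. -/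
open Matrix

/-- Two-level correction operators are intertwined by `T` when `T` has right inverse `Tᵀ` and
intertwines both the operators `B`, `A` and the iteration matrices `H`, `G`. -/
theorem Matrix.twoLevel_intertwine {s a m R : Type*} [Fintype s] [Fintype a] [Fintype m]
    [DecidableEq s] [DecidableEq a] [DecidableEq m] [CommRing R]
    {T : Matrix s a R} {A G : Matrix s s R} {B H : Matrix a a R}
    (hT : T * Tᵀ = 1) (hB : T * B = A * T) (hH : T * H = G * T)
    (P : Matrix s m R) (Q : Matrix m s R) :
    Q * T * B * (Tᵀ * P) = Q * A * P ∧
      (1 - P * (Q * A * P)⁻¹ * Q * A) * G * T =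
        T * ((1 - Tᵀ * P * (Q * T * B * (Tᵀ * P))⁻¹ * (Q * T) * B) * H) := by
  have coarse : Q * T * B * (Tᵀ * P) = Q * A * P := by
    rw [Matrix.mul_assoc Q T B, hB, ← Matrix.mul_assoc, ← Matrix.mul_assoc,
      Matrix.mul_assoc (Q * A) T, hT, Matrix.mul_one]
  refine ⟨coarse, ?_⟩
  rw [coarse]
  generalize (Q * A * P)⁻¹ = K
  have corr : T * (1 - Tᵀ * P * K * (Q * T) * B) = (1 - P * K * Q * A) * T := by
    have h : T * (Tᵀ * P * K * (Q * T) * B) = T * Tᵀ * (P * K * Q) * (T * B) := by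
      simp only [Matrix.mul_assoc]
    rw [Matrix.mul_sub, h, hT, hB, Matrix.sub_mul]
    simp only [Matrix.mul_assoc, Matrix.mul_one, Matrix.one_mul]
  rw [← Matrix.mul_assoc T, corr, Matrix.mul_assoc _ T, hH, Matrix.mul_assoc, Matrix.mul_assoc]

theorem stmt15
    (N1a N2a N1 N2 M : ℕ) (hN1a : 0 < N1a) (hN2a : 0 < N2a) (hN1 : 0 < N1) (hN2 : 0 < N2)
    (hM : 0 < M)
    (A₁ : Matrix (Fin N1a) (Fin N1a) ℝ) (A₂ : Matrix (Fin N2a) (Fin N2a) ℝ)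
    (hA₁ : IsUnit A₁) (hA₂ : IsUnit A₂)
    (E₁ : Matrix (Fin N1a) (Fin N1) ℝ) (E₂ : Matrix (Fin N2a) (Fin N2) ℝ)
    (R₁ : Matrix (Fin N1) (Fin N2a) ℝ) (R₂ : Matrix (Fin N2) (Fin N1a) ℝ)
    (hR₁ : R₁ * R₁ᵀ = 1) (hR₂ : R₂ * R₂ᵀ = 1)
    (Aa : Matrix (Fin N1a ⊕ Fin N2a) (Fin N1a ⊕ Fin N2a) ℝ)
    (hAa : Aa = Matrix.fromBlocks A₁ (E₁ * R₁) (E₂ * R₂) A₂)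
    (As : Matrix (Fin N2 ⊕ Fin N1) (Fin N2 ⊕ Fin N1) ℝ)
    (hAs : As = Matrix.fromBlocks 1 (R₂ * A₁⁻¹ * E₁) (R₁ * A₂⁻¹ * E₂) 1)
    (Ga : Matrix (Fin N1a ⊕ Fin N2a) (Fin N1a ⊕ Fin N2a) ℝ)
    (hGa : Ga = Matrix.fromBlocks 0 (-(A₁⁻¹ * E₁ * R₁)) (-(A₂⁻¹ * E₂ * R₂)) 0)
    (Gs : Matrix (Fin N2 ⊕ Fin N1) (Fin N2 ⊕ Fin N1) ℝ)
    (hGs : Gs = Matrix.fromBlocks 0 (-(R₂ * A₁⁻¹ * E₁)) (-(R₁ * A₂⁻¹ * E₂)) 0)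
    (Tt : Matrix (Fin N2 ⊕ Fin N1) (Fin N1a ⊕ Fin N2a) ℝ)
    (hTt : Tt = Matrix.fromBlocks R₂ 0 0 R₁)
    (D : Matrix (Fin N1a ⊕ Fin N2a) (Fin N1a ⊕ Fin N2a) ℝ)
    (hD : D = Matrix.fromBlocks A₁⁻¹ 0 0 A₂⁻¹)
    (Ps : Matrix (Fin N2 ⊕ Fin N1) (Fin M) ℝ)
    (Rs : Matrix (Fin M) (Fin N2 ⊕ Fin N1) ℝ) (hRs : Rs = Psᵀ)
    (hinv : IsUnit (Rs * As * Ps))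
    (Gs2L : Matrix (Fin N2 ⊕ Fin N1) (Fin N2 ⊕ Fin N1) ℝ)
    (hGs2L : Gs2L = (1 - Ps * (Rs * As * Ps)⁻¹ * Rs * As) * Gs)
    (Pa : Matrix (Fin N1a ⊕ Fin N2a) (Fin M) ℝ) (hPa : Pa = Ttᵀ * Ps)
    (Ra : Matrix (Fin M) (Fin N1a ⊕ Fin N2a) ℝ) (hRa : Ra = Rs * Tt)
    (Ga2L : Matrix (Fin N1a ⊕ Fin N2a) (Fin N1a ⊕ Fin N2a) ℝ)
    (hGa2L : Ga2L = (1 - Pa * (Ra * D * Aa * Pa)⁻¹ * Ra * D * Aa) * Ga) :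
    Ra * D * Aa * Pa = Rs * As * Ps ∧ Gs2L * Tt = Tt * Ga2L := by
  subst hGs2L hGa2L hPa hRa
  have hT : Tt * Ttᵀ = 1 := by
    simp [hTt, fromBlocks_transpose, fromBlocks_multiply, hR₁, hR₂]
  have hB : Tt * (D * Aa) = As * Tt := by
    have h₁ : A₁⁻¹ * A₁ = 1 := nonsing_inv_mul _ ((isUnit_iff_isUnit_det _).mp hA₁)
    have h₂ : A₂⁻¹ * A₂ = 1 := nonsing_inv_mul _ ((isUnit_iff_isUnit_det _).mp hA₂)
    simp [hTt, hD, hAa, hAs, fromBlocks_multiply, Matrix.mul_assoc, h₁, h₂]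
  have hH : Tt * Ga = Gs * Tt := by
    simp [hTt, hGa, hGs, fromBlocks_multiply, Matrix.mul_assoc]
  simpa only [Matrix.mul_assoc] using twoLevel_intertwine hT hB hH Ps Rs
end

section
/- Let P_s ∈ ℝ^{N^s×M} with R_s = P_sᵀ, assume R_sA_sP_s is invertible, and assume E₁ᵀE₁ = I_{N₁} and E₂ᵀE₂ = I_{N₂}. Define G_s^{2L} = [I_{N^s} − P_s(R_sA_sP_s)^{-1}R_sA_s]G_s, P_a = T̃ᵀP_s, R_a = R_sT̃, and, for any invertible U ∈ ℝ^{M×M}, set P̃_a = P_aU, R̃_a = U^{-1}R_a, and G_a^{2L} = [I_{N^a} − P̃_a(R̃_aDA_aP̃_a)^{-1}R̃_aDA_a]G_a. Then G_s^{2L} and G_a^{2L} have the same nonzero eigenvalues: for every complex number λ ≠ 0, λ is an eigenvalue of (the complexification of) G_s^{2L} if and only if λ is an eigenvalue of (the complexification of) G_a^{2L}. -/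
open Matrix

theorem Matrix.mem_spectrum_mul_comm {K m n : Type*} [Field K] [Fintype m] [Fintype n]
    [DecidableEq m] [DecidableEq n] (A : Matrix m n K) (B : Matrix n m K) {r : K} (hr : r ≠ 0) :
    r ∈ spectrum K (A * B) ↔ r ∈ spectrum K (B * A) := by
  have h := congrArg (Polynomial.eval r) (Matrix.charpoly_mul_comm' A B)
  simp only [Polynomial.eval_mul, Polynomial.eval_pow, Polynomial.eval_X] at h
  rw [Matrix.mem_spectrum_iff_isRoot_charpoly, Matrix.mem_spectrum_iff_isRoot_charpoly,
    Polynomial.IsRoot, Polynomial.IsRoot, ← mul_eq_zero_iff_left (pow_ne_zero (Fintype.card n) hr),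
    h, mul_eq_zero_iff_left (pow_ne_zero (Fintype.card m) hr)]

theorem stmt16
    (N1a N2a N1 N2 M : ℕ) (hN1a : 0 < N1a) (hN2a : 0 < N2a) (hN1 : 0 < N1) (hN2 : 0 < N2)
    (hM : 0 < M)
    (A₁ : Matrix (Fin N1a) (Fin N1a) ℝ) (A₂ : Matrix (Fin N2a) (Fin N2a) ℝ)
    (hA₁ : IsUnit A₁) (hA₂ : IsUnit A₂)
    (E₁ : Matrix (Fin N1a) (Fin N1) ℝ) (E₂ : Matrix (Fin N2a) (Fin N2) ℝ)
    (R₁ : Matrix (Fin N1) (Fin N2a) ℝ) (R₂ : Matrix (Fin N2) (Fin N1a) ℝ)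
    (hR₁ : R₁ * R₁ᵀ = 1) (hR₂ : R₂ * R₂ᵀ = 1)
    (hE₁ : E₁ᵀ * E₁ = 1) (hE₂ : E₂ᵀ * E₂ = 1)
    (Aa : Matrix (Fin N1a ⊕ Fin N2a) (Fin N1a ⊕ Fin N2a) ℝ)
    (hAa : Aa = Matrix.fromBlocks A₁ (E₁ * R₁) (E₂ * R₂) A₂)
    (As : Matrix (Fin N2 ⊕ Fin N1) (Fin N2 ⊕ Fin N1) ℝ)
    (hAs : As = Matrix.fromBlocks 1 (R₂ * A₁⁻¹ * E₁) (R₁ * A₂⁻¹ * E₂) 1)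
    (Ga : Matrix (Fin N1a ⊕ Fin N2a) (Fin N1a ⊕ Fin N2a) ℝ)
    (hGa : Ga = Matrix.fromBlocks 0 (-(A₁⁻¹ * E₁ * R₁)) (-(A₂⁻¹ * E₂ * R₂)) 0)
    (Gs : Matrix (Fin N2 ⊕ Fin N1) (Fin N2 ⊕ Fin N1) ℝ)
    (hGs : Gs = Matrix.fromBlocks 0 (-(R₂ * A₁⁻¹ * E₁)) (-(R₁ * A₂⁻¹ * E₂)) 0)
    (Tt : Matrix (Fin N2 ⊕ Fin N1) (Fin N1a ⊕ Fin N2a) ℝ)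
    (hTt : Tt = Matrix.fromBlocks R₂ 0 0 R₁)
    (D : Matrix (Fin N1a ⊕ Fin N2a) (Fin N1a ⊕ Fin N2a) ℝ)
    (hD : D = Matrix.fromBlocks A₁⁻¹ 0 0 A₂⁻¹)
    (Ps : Matrix (Fin N2 ⊕ Fin N1) (Fin M) ℝ)
    (Rs : Matrix (Fin M) (Fin N2 ⊕ Fin N1) ℝ) (hRs : Rs = Psᵀ)
    (hinv : IsUnit (Rs * As * Ps))
    (Gs2L : Matrix (Fin N2 ⊕ Fin N1) (Fin N2 ⊕ Fin N1) ℝ)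
    (hGs2L : Gs2L = (1 - Ps * (Rs * As * Ps)⁻¹ * Rs * As) * Gs)
    (Pa : Matrix (Fin N1a ⊕ Fin N2a) (Fin M) ℝ) (hPa : Pa = Ttᵀ * Ps)
    (Ra : Matrix (Fin M) (Fin N1a ⊕ Fin N2a) ℝ) (hRa : Ra = Rs * Tt)
    (U : Matrix (Fin M) (Fin M) ℝ) (hU : IsUnit U)
    (Pat : Matrix (Fin N1a ⊕ Fin N2a) (Fin M) ℝ) (hPat : Pat = Pa * U)
    (Rat : Matrix (Fin M) (Fin N1a ⊕ Fin N2a) ℝ) (hRat : Rat = U⁻¹ * Ra)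
    (Ga2L : Matrix (Fin N1a ⊕ Fin N2a) (Fin N1a ⊕ Fin N2a) ℝ)
    (hGa2L : Ga2L = (1 - Pat * (Rat * D * Aa * Pat)⁻¹ * Rat * D * Aa) * Ga) :
    ∀ lam : ℂ, lam ≠ 0 →
      (lam ∈ spectrum ℂ (Gs2L.map (algebraMap ℝ ℂ)) ↔
        lam ∈ spectrum ℂ (Ga2L.map (algebraMap ℝ ℂ))) := by
  intro lam hlam
  have hTT : Tt * Ttᵀ = 1 := by
    rw [hTt, fromBlocks_transpose, fromBlocks_multiply]
    simp [hR₁, hR₂]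
  have hdet₁ := (isUnit_iff_isUnit_det A₁).1 hA₁
  have hdet₂ := (isUnit_iff_isUnit_det A₂).1 hA₂
  have hTDA : Tt * (D * Aa) = As * Tt := by
    rw [hTt, hD, hAa, hAs]
    simp [fromBlocks_multiply, Matrix.mul_assoc, nonsing_inv_mul _ hdet₁,
      nonsing_inv_mul _ hdet₂]
  obtain ⟨X, hX, hTX⟩ : ∃ X : Matrix (Fin N1a ⊕ Fin N2a) (Fin N2 ⊕ Fin N1) ℝ,
      Ga = X * Tt ∧ Tt * X = Gs := by
    refine ⟨fromBlocks 0 (-(A₁⁻¹ * E₁)) (-(A₂⁻¹ * E₂)) 0, ?_, ?_⟩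
    · simp [hGa, hTt, fromBlocks_multiply]
    · simp [hGs, hTt, fromBlocks_multiply, Matrix.mul_assoc]
  have hUdet := (isUnit_iff_isUnit_det U).1 hU
  have hcoarse : Rat * D * Aa * Pat = U⁻¹ * (Rs * As * Ps) * U := by
    calc Rat * D * Aa * Pat = U⁻¹ * (Rs * (Tt * (D * Aa)) * Ttᵀ * Ps) * U := by
          simp only [hRat, hRa, hPat, hPa, Matrix.mul_assoc]
      _ = U⁻¹ * (Rs * As * (Tt * Ttᵀ) * Ps) * U := by
          simp only [hTDA, Matrix.mul_assoc]
      _ = U⁻¹ * (Rs * As * Ps) * U := by rw [hTT, Matrix.mul_one]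
  obtain ⟨Q, hQ⟩ : ∃ Q, Q = Ps * (Rs * As * Ps)⁻¹ * Rs * As := ⟨_, rfl⟩
  have hproj : Pat * (Rat * D * Aa * Pat)⁻¹ * Rat * D * Aa = Ttᵀ * Q * Tt := by
    rw [hcoarse, Matrix.mul_inv_rev, Matrix.mul_inv_rev, nonsing_inv_nonsing_inv _ hUdet]
    calc Pat * (U⁻¹ * ((Rs * As * Ps)⁻¹ * U)) * Rat * D * Aa
        = Ttᵀ * Ps * (U * U⁻¹) * (Rs * As * Ps)⁻¹ * (U * U⁻¹) * Rs * (Tt * (D * Aa)) := by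
          simp only [hRat, hRa, hPat, hPa, Matrix.mul_assoc]
      _ = Ttᵀ * Q * Tt := by
          rw [mul_nonsing_inv _ hUdet, hTDA, hQ]
          simp only [Matrix.mul_one, Matrix.mul_assoc]
  have ha : Ga2L = ((1 - Ttᵀ * Q * Tt) * X) * Tt := by
    rw [hGa2L, hproj, hX, ← Matrix.mul_assoc]
  have hs : Gs2L = Tt * ((1 - Ttᵀ * Q * Tt) * X) := by
    have hT : Tt * (1 - Ttᵀ * Q * Tt) = (1 - Q) * Tt := by
      rw [Matrix.mul_sub, Matrix.sub_mul, ← Matrix.mul_assoc, ← Matrix.mul_assoc, hTT]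
      simp
    rw [← Matrix.mul_assoc, hT, Matrix.mul_assoc, hTX, hGs2L, hQ]
  rw [ha, hs, Matrix.map_mul (L := Tt), Matrix.map_mul (M := Tt)]
  exact Matrix.mem_spectrum_mul_comm _ _ hlam
end

section
/- One iteration of the S2S-B2 algorithm coincides with one step of the two-level stationary method with iteration matrix G(I − PA_c^{-1}RA): for all u⁰, b ∈ ℝ^N, setting v = Gu⁰, r = b − u⁰ + v, d = A_c^{-1}Rr, and u¹ = v + (GP)d + b, one has u¹ = G(I − PA_c^{-1}RA)u⁰ + (I + GPA_c^{-1}R)b; in particular, when b = 0, u¹ = G(I − PA_c^{-1}RA)u⁰. -/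
open Matrix

theorem stmt17
    (N M : ℕ) (hN : 0 < N) (hM : 0 < M)
    (G : Matrix (Fin N) (Fin N) ℝ)
    (P : Matrix (Fin N) (Fin M) ℝ) (R : Matrix (Fin M) (Fin N) ℝ)
    (A : Matrix (Fin N) (Fin N) ℝ) (hA : A = 1 - G)
    (Ac : Matrix (Fin M) (Fin M) ℝ) (hAc : Ac = R * A * P) (hAcInv : IsUnit Ac) :
    ∀ u0 b : Fin N → ℝ,
      ∀ v r : Fin N → ℝ, ∀ d : Fin M → ℝ, ∀ u1 : Fin N → ℝ,
      v = G.mulVec u0 → r = b - u0 + v → d = Ac⁻¹.mulVec (R.mulVec r) →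
      u1 = v + (G * P).mulVec d + b →
      u1 = (G * (1 - P * Ac⁻¹ * R * A)).mulVec u0 + (1 + G * P * Ac⁻¹ * R).mulVec b ∧
      (b = 0 → u1 = (G * (1 - P * Ac⁻¹ * R * A)).mulVec u0) := by
  rintro u0 b v r d u1 rfl hr rfl rfl
  have hres : r = b - A *ᵥ u0 := by
    rw [hr, hA, sub_mulVec, one_mulVec]
    abel
  have hstep : G *ᵥ u0 + (G * P) *ᵥ (Ac⁻¹ *ᵥ (R *ᵥ r)) + b =
      (G * (1 - P * Ac⁻¹ * R * A)) *ᵥ u0 + (1 + G * P * Ac⁻¹ * R) *ᵥ b := by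
    rw [hres]
    simp only [mulVec_sub, Matrix.mul_sub, sub_mulVec, add_mulVec, mulVec_mulVec, one_mulVec,
      Matrix.mul_one, Matrix.mul_assoc]
    abel
  refine ⟨hstep, fun hb => ?_⟩
  rw [hstep, hb, mulVec_zero, add_zero]
end
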